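/- Explicit value of the Stokes velocity on the unit sphere: For every θ ∈ [0,π], u₀(e(θ,0)) = (1/15) cos θ · e(θ,0) − (2/15) sin θ · ∂_θ e(θ,0) − (1/3) e₃, where ∂_θ e(θ,0) = (cos θ, 0, −sin θ). -/

import Mathlib

/- Explicit value of the Stokes velocity u₀(x) = −∫_{B(0,1)} Φ(x−y) e₃ dy on the unit sphere:
   u₀(e(θ,0)) = (cos θ/15) e(θ,0) − (2 sin θ/15) ∂_θe(θ,0) − (1/3) e₃,
   where ∂_θe(θ,0) = (cos θ, 0, −sin θ). -/

noncomputable section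
open MeasureTheory Real Set Filter RealInnerProductSpace

def V3 (a b c : ℝ) : EuclideanSpace ℝ (Fin 3) := (WithLp.equiv 2 (Fin 3 → ℝ)).symm ![a, b, c]

def e3 : EuclideanSpace ℝ (Fin 3) := V3 0 0 1

/-- Spherical parametrization `e(θ,φ) = (cos φ sin θ, sin φ sin θ, cos θ)`. -/
def eSph (θ φ : ℝ) : EuclideanSpace ℝ (Fin 3) :=
  V3 (Real.cos φ * Real.sin θ) (Real.sin φ * Real.sin θ) (Real.cos θ)

/-- Oseen tensor `Φ(x) = (8π)⁻¹ (I₃/|x| + x⊗x/|x|³)` applied to a vector `v`. -/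
def oseen (x v : EuclideanSpace ℝ (Fin 3)) : EuclideanSpace ℝ (Fin 3) :=
  (8 * π)⁻¹ • (‖x‖⁻¹ • v + (‖x‖ ^ 3)⁻¹ • (⟪x, v⟫ • x))

/-- `u₀(x) = −∫_{B(0,1)} Φ(x−y) e₃ dy`. -/
def u0 (x : EuclideanSpace ℝ (Fin 3)) : EuclideanSpace ℝ (Fin 3) :=
  -∫ y in Metric.ball (0 : EuclideanSpace ℝ (Fin 3)) 1, oseen (x - y) e3


abbrev E3 := EuclideanSpace ℝ (Fin 3)

lemma polar_integral (F : E3 → ℝ) (hF : Integrable F) :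
    ∫ z, F z = ∫ w : Metric.sphere (0 : E3) 1, (∫ r in Ioi (0:ℝ), r ^ 2 * F (r • (w : E3)))
      ∂(volume : Measure E3).toSphere := by
  have hd : Module.finrank ℝ E3 - 1 = 2 := by simp
  have hmp := (volume : Measure E3).measurePreserving_homeomorphUnitSphereProd
  rw [hd] at hmp
  let G : Metric.sphere (0 : E3) 1 × Ioi (0:ℝ) → ℝ := fun p => F ((p.2 : ℝ) • (p.1 : E3))
  have hcomp : ∀ x : ({(0:E3)}ᶜ : Set E3), G (homeomorphUnitSphereProd E3 x) = F x := by
    intro x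
    have : (homeomorphUnitSphereProd E3).symm (homeomorphUnitSphereProd E3 x) = x :=
      Homeomorph.symm_apply_apply _ _
    have h2 := congrArg Subtype.val this
    simp only [homeomorphUnitSphereProd_symm_apply_coe] at h2
    simp only [G]
    rw [h2]
  have hGi : Integrable G ((volume : Measure E3).toSphere.prod (Measure.volumeIoiPow 2)) := by
    rw [← hmp.integrable_comp_emb (Homeomorph.measurableEmbedding _)]
    have : (G ∘ homeomorphUnitSphereProd E3) = F ∘ Subtype.val := funext hcomp
    rw [this, ← integrableOn_iff_comap_subtypeVal (measurableSet_singleton _).compl]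
    exact hF.integrableOn
  calc ∫ z, F z = ∫ x : ({(0:E3)}ᶜ : Set E3), F x ∂((volume : Measure E3).comap (↑)) := by
        rw [integral_subtype_comap (measurableSet_singleton _).compl fun x ↦ F x,
          restrict_compl_singleton]
    _ = ∫ p, G p ∂((volume : Measure E3).toSphere.prod (Measure.volumeIoiPow 2)) := by
        rw [← hmp.integral_comp (Homeomorph.measurableEmbedding _)]
        simp only [hcomp]
    _ = _ := by
        rw [integral_prod _ hGi]
        congr 1
        ext w
        simp only [Measure.volumeIoiPow, ENNReal.ofReal]
        rw [integral_withDensity_eq_integral_smul,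
          integral_subtype_comap measurableSet_Ioi
            fun a : ℝ ↦ Real.toNNReal (a ^ 2) • F (a • (w : E3)),
          setIntegral_congr_fun measurableSet_Ioi fun x hx ↦ ?_]
        · rw [NNReal.smul_def, Real.coe_toNNReal _ (pow_nonneg (le_of_lt hx) _)]; rfl
        · exact (measurable_subtype_coe.pow_const _).real_toNNReal

lemma half_moment (n : ℕ) :
    ∫ x in Ioi (0:ℝ), x ^ n * exp (-x ^ 2) = Gamma (((n:ℝ) + 1) / 2) / 2 := by
  have := integral_rpow_mul_exp_neg_rpow (p := 2) (q := n) (by norm_num)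
    (by have : (0:ℝ) ≤ n := n.cast_nonneg
        linarith)
  rw [show Gamma (((n:ℝ) + 1) / 2) / 2 = (1 / 2) * Gamma (((n:ℝ) + 1) / 2) by ring, ← this]
  refine setIntegral_congr_fun measurableSet_Ioi fun x hx ↦ ?_
  simp [Real.rpow_natCast]

lemma g1 : Gamma (3/2) = √π / 2 := by
  rw [show (3/2:ℝ) = 1/2 + 1 by norm_num, Real.Gamma_add_one (by norm_num), Real.Gamma_one_half_eq]
  ring
lemma g2 : Gamma (5/2) = 3 * √π / 4 := by
  rw [show (5/2:ℝ) = 3/2 + 1 by norm_num, Real.Gamma_add_one (by norm_num), g1]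
  ring
lemma g3 : Gamma (7/2) = 15 * √π / 8 := by
  rw [show (7/2:ℝ) = 5/2 + 1 by norm_num, Real.Gamma_add_one (by norm_num), g2]
  ring

def M (n : ℕ) : ℝ := ∫ x : ℝ, x ^ n * exp (-x ^ 2)

lemma M_int (n : ℕ) : Integrable fun x : ℝ => x ^ n * exp (-x ^ 2) := by
  have := integrable_rpow_mul_exp_neg_mul_sq (b := 1) (by norm_num) (s := n)
    (by have : (0:ℝ) ≤ n := n.cast_nonneg
        linarith)
  simpa [Real.rpow_natCast] using this

lemma M_odd (n : ℕ) (hn : Odd n) : M n = 0 := by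
  have h : M n = - M n := by
    unfold M
    conv_lhs => rw [← integral_neg_eq_self]
    rw [← integral_neg]
    congr 1
    ext x
    simp [hn.neg_pow]
  linarith

lemma M_even (n : ℕ) (hn : Even n) : M n = Gamma (((n:ℝ) + 1) / 2) := by
  have := integral_comp_abs (f := fun x : ℝ => x ^ n * exp (-x ^ 2))
  simp only [hn.pow_abs, sq_abs, half_moment] at this
  unfold M
  rw [this]; ring

lemma M0 : M 0 = √π := by rw [M_even 0 (by decide)]; simp [← Real.Gamma_one_half_eq]
lemma M2 : M 2 = √π / 2 := by rw [M_even 2 (by decide), ← g1]; norm_num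
lemma M4 : M 4 = 3 * √π / 4 := by rw [M_even 4 (by decide), ← g2]; norm_num
lemma M1 : M 1 = 0 := M_odd 1 (by decide)
lemma M3 : M 3 = 0 := M_odd 3 (by decide)

def mono (a b c : ℕ) (z : E3) : ℝ := z 0 ^ a * z 1 ^ b * z 2 ^ c * exp (-‖z‖ ^ 2)

lemma mono_eq (a b c : ℕ) (v : Fin 3 → ℝ) : mono a b c (WithLp.toLp 2 v) =
    ∏ i, (fun x : ℝ => x ^ (![a, b, c] i) * exp (-x ^ 2)) (v i) := by
  simp only [mono, EuclideanSpace.norm_sq_eq, Fin.prod_univ_three, Fin.sum_univ_three,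
    Real.norm_eq_abs, sq_abs]
  rw [show -(v 0 ^ 2 + v 1 ^ 2 + v 2 ^ 2) = -v 0 ^ 2 + -v 1 ^ 2 + -v 2 ^ 2 by ring,
    Real.exp_add, Real.exp_add]
  simp
  ring

lemma mono_int (a b c : ℕ) : Integrable (mono a b c) := by
  rw [← (PiLp.volume_preserving_toLp (Fin 3)).integrable_comp_emb
    (MeasurableEquiv.toLp 2 (Fin 3 → ℝ)).measurableEmbedding]
  have : (mono a b c ∘ WithLp.toLp 2) = fun v : Fin 3 → ℝ =>
    ∏ i, (fun x : ℝ => x ^ (![a, b, c] i) * exp (-x ^ 2)) (v i) := funext (mono_eq a b c)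
  rw [this]
  exact Integrable.fintype_prod (f := fun (i : Fin 3) (x : ℝ) => x ^ (![a, b, c] i) * exp (-x ^ 2))
    fun i => M_int _

lemma mono_integral (a b c : ℕ) : ∫ z, mono a b c z = M a * M b * M c := by
  rw [← (PiLp.volume_preserving_toLp (Fin 3)).integral_comp
    (MeasurableEquiv.toLp 2 (Fin 3 → ℝ)).measurableEmbedding]
  simp_rw [mono_eq]
  rw [integral_fintype_prod_volume_eq_prod
    (f := fun (i : Fin 3) (x : ℝ) => x ^ (![a, b, c] i) * exp (-x ^ 2))]
  simp [Fin.prod_univ_three, M]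

def Kf (Q : E3 → ℝ) (z : E3) : ℝ := (‖z‖ ^ 3)⁻¹ * Q z

lemma Kf_int (Q : E3 → ℝ) (hc : Continuous Q) (hb : ∀ z, |Q z| ≤ 2 * ‖z‖ ^ 2) :
    IntegrableOn (Kf Q) (Metric.ball 0 3) := by
  have h1 : IntegrableOn (fun z : E3 => 2 * ‖z‖⁻¹) (Metric.ball (0 : E3) 3) := by
    refine (integrableOn_fun_norm_addHaar (volume : Measure E3) (f := fun r => 2 * r⁻¹)).2 ?_
    have hd : Module.finrank ℝ E3 - 1 = 2 := by simp
    rw [hd]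
    have h2 : IntegrableOn (fun y : ℝ => 2 * y) (Ioo 0 3) :=
      (Continuous.integrableOn_Icc (by fun_prop)).mono_set Ioo_subset_Icc_self
    refine h2.congr_fun (fun y hy => ?_) measurableSet_Ioo
    have : y ≠ 0 := hy.1.ne'
    simp only [smul_eq_mul]
    field_simp
  refine Integrable.mono' h1 ?_ (ae_of_all _ fun z => ?_)
  · have : Measurable (Kf Q) := by
      unfold Kf
      exact ((measurable_norm.pow_const 3).inv).mul hc.measurable
    exact this.aestronglyMeasurable
  · rw [Real.norm_eq_abs, Kf, abs_mul, abs_of_nonneg (by positivity)]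
    by_cases hz : ‖z‖ = 0
    · simp [hz]
    · calc (‖z‖ ^ 3)⁻¹ * |Q z| ≤ (‖z‖ ^ 3)⁻¹ * (2 * ‖z‖ ^ 2) := by gcongr; exact hb z
        _ = 2 * ‖z‖⁻¹ := by field_simp

lemma mem_ball_iff' (x z : E3) (hx : ‖x‖ = 1) : z ∈ Metric.ball x 1 ↔ ‖z‖ ^ 2 < 2 * ⟪z, x⟫ := by
  rw [mem_ball_iff_norm, ← sq_lt_one_iff₀ (norm_nonneg _), norm_sub_sq_real, hx]
  constructor <;> intro h <;> linarith

lemma ball_subset_three (x : E3) (hx : ‖x‖ = 1) : Metric.ball x 1 ⊆ Metric.ball 0 3 := by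
  intro z hz
  rw [mem_ball_iff_norm] at hz
  rw [mem_ball_zero_iff]
  have := norm_sub_norm_le z x
  linarith

lemma ball_integral (Q : E3 → ℝ) (hc : Continuous Q) (hb : ∀ z, |Q z| ≤ 2 * ‖z‖ ^ 2)
    (hh : ∀ (r : ℝ) z, Q (r • z) = r ^ 2 * Q z) (x : E3) (hx : ‖x‖ = 1)
    (hg : Integrable fun z : E3 => ⟪z, x⟫ ^ 2 * Q z * exp (-‖z‖ ^ 2)) :
    ∫ z in Metric.ball x 1, Kf Q z =
      (15 * √π / 16)⁻¹ * ∫ z : E3, ⟪z, x⟫ ^ 2 * Q z * exp (-‖z‖ ^ 2) := by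
  have hnx : ‖-x‖ = 1 := by rw [norm_neg, hx]
  have hK := Kf_int Q hc hb
  have hneg : ∀ z, Kf Q (-z) = Kf Q z := by
    intro z
    have := hh (-1) z
    simp only [neg_smul, one_smul] at this
    simp [Kf, this]
  -- symmetrise
  have hsym : ∫ z in Metric.ball (-x) 1, Kf Q z = ∫ z in Metric.ball x 1, Kf Q z := by
    rw [← integral_indicator Metric.isOpen_ball.measurableSet,
      ← integral_indicator Metric.isOpen_ball.measurableSet, ← integral_neg_eq_self]
    congr 1
    ext z
    by_cases h : z ∈ Metric.ball x 1
    · have h' : -z ∈ Metric.ball (-x) 1 := by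
        rw [mem_ball_iff' _ _ hx] at h
        rw [mem_ball_iff' _ _ hnx]; simpa using h
      rw [indicator_of_mem h, indicator_of_mem h', hneg]
    · have h' : -z ∉ Metric.ball (-x) 1 := by
        rw [mem_ball_iff' _ _ hx] at h
        rw [mem_ball_iff' _ _ hnx]; simpa using h
      rw [indicator_of_notMem h, indicator_of_notMem h']
  have hdisj : Disjoint (Metric.ball x 1) (Metric.ball (-x) 1) := by
    rw [Set.disjoint_left]
    intro z h h'
    rw [mem_ball_iff' _ _ hx] at h
    rw [mem_ball_iff' _ _ hnx, inner_neg_right] at h'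
    nlinarith [sq_nonneg ‖z‖]
  have hU := setIntegral_union hdisj Metric.isOpen_ball.measurableSet
    (hK.mono_set (ball_subset_three x hx)) (hK.mono_set (ball_subset_three (-x) hnx))
  rw [hsym, ← integral_indicator (Metric.isOpen_ball.measurableSet.union
    Metric.isOpen_ball.measurableSet)] at hU
  have hUi : Integrable (indicator (Metric.ball x 1 ∪ Metric.ball (-x) 1) (Kf Q)) := by
    rw [integrable_indicator_iff (Metric.isOpen_ball.measurableSet.union
      Metric.isOpen_ball.measurableSet)]
    exact hK.mono_set (union_subset (ball_subset_three x hx) (ball_subset_three (-x) hnx))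
  rw [polar_integral _ hUi] at hU
  rw [polar_integral _ hg]
  have e1 : ∀ w : Metric.sphere (0 : E3) 1, (∫ r in Ioi (0:ℝ), r ^ 2 *
      (indicator (Metric.ball x 1 ∪ Metric.ball (-x) 1) (Kf Q)) (r • (w : E3))) =
      2 * (⟪(w : E3), x⟫ ^ 2 * Q w) := by
    intro w
    have hw : ‖(w : E3)‖ = 1 := by simp
    have e : ∀ r ∈ Ioi (0:ℝ), r ^ 2 *
      (indicator (Metric.ball x 1 ∪ Metric.ball (-x) 1) (Kf Q)) (r • (w : E3)) =
        (Iio (2 * |⟪(w : E3), x⟫|)).indicator (fun r => r * Q w) r := by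
      intro r hr
      have hr : 0 < r := hr
      have hm : r • (w : E3) ∈ Metric.ball x 1 ∪ Metric.ball (-x) 1 ↔
          r ∈ Iio (2 * |⟪(w : E3), x⟫|) := by
        rw [mem_union, mem_ball_iff' _ _ hx, mem_ball_iff' _ _ hnx, inner_neg_right,
          real_inner_smul_left, norm_smul, hw, mem_Iio, Real.norm_eq_abs, abs_of_pos hr,
          show (2:ℝ) * |⟪(w : E3), x⟫| = |2 * ⟪(w : E3), x⟫| by simp [abs_mul], lt_abs]
        refine or_congr ?_ ?_
        · constructor <;> intro h <;> nlinarith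
        · constructor <;> intro h <;> nlinarith
      by_cases h : r ∈ Iio (2 * |⟪(w : E3), x⟫|)
      · rw [indicator_of_mem h, indicator_of_mem (hm.2 h), Kf, hh, norm_smul, hw,
          Real.norm_eq_abs, abs_of_pos hr]
        field_simp
      · rw [indicator_of_notMem h, indicator_of_notMem (fun h' => h (hm.1 h')), mul_zero]
    rw [setIntegral_congr_fun measurableSet_Ioi e, setIntegral_indicator measurableSet_Iio,
      Ioi_inter_Iio, ← integral_Ioc_eq_integral_Ioo,
      ← intervalIntegral.integral_of_le (by positivity), intervalIntegral.integral_mul_const,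
      integral_id]
    have := sq_abs ⟪(w : E3), x⟫
    linear_combination 2 * Q w * this
  have e2 : ∀ w : Metric.sphere (0 : E3) 1, (∫ r in Ioi (0:ℝ), r ^ 2 *
      (⟪r • (w : E3), x⟫ ^ 2 * Q (r • (w : E3)) * exp (-‖r • (w : E3)‖ ^ 2))) =
      (15 * √π / 16) * (⟪(w : E3), x⟫ ^ 2 * Q w) := by
    intro w
    have hw : ‖(w : E3)‖ = 1 := by simp
    have e : ∀ r : ℝ, r ^ 2 *
      (⟪r • (w : E3), x⟫ ^ 2 * Q (r • (w : E3)) * exp (-‖r • (w : E3)‖ ^ 2)) =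
        (r ^ 6 * exp (-r ^ 2)) * (⟪(w : E3), x⟫ ^ 2 * Q w) := by
      intro r
      rw [real_inner_smul_left, hh, norm_smul, hw, Real.norm_eq_abs, mul_one, sq_abs]
      ring
    simp_rw [e]
    rw [integral_mul_const, half_moment]
    have h7 : (((6 : ℕ) : ℝ) + 1) / 2 = 7 / 2 := by norm_num
    rw [h7, g3]
    ring
  simp_rw [e1] at hU
  simp_rw [e2]
  rw [integral_const_mul] at hU ⊢
  have : √π ≠ 0 := (Real.sqrt_pos.2 Real.pi_pos).ne'
  rw [inv_mul_cancel_left₀ (by positivity)]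
  linarith

lemma V3_0 (a b c : ℝ) : V3 a b c 0 = a := rfl
lemma V3_1 (a b c : ℝ) : V3 a b c 1 = b := rfl
lemma V3_2 (a b c : ℝ) : V3 a b c 2 = c := rfl

lemma inner3 (z x : E3) : ⟪z, x⟫ = z 0 * x 0 + z 1 * x 1 + z 2 * x 2 := by
  simp [PiLp.inner_apply, Fin.sum_univ_three]; ring

lemma norm3 (z : E3) : ‖z‖ ^ 2 = z 0 ^ 2 + z 1 ^ 2 + z 2 ^ 2 := by
  simp [EuclideanSpace.norm_sq_eq, Fin.sum_univ_three]

/-- The quadratic numerator of the `j`-th coordinate. -/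
def Qf (j : Fin 3) (z : E3) : ℝ := ‖z‖ ^ 2 * e3 j + z 2 * z j

lemma Qf_cont (j : Fin 3) : Continuous (Qf j) := by
  unfold Qf; fun_prop

lemma Qf_bound (j : Fin 3) (z : E3) : |Qf j z| ≤ 2 * ‖z‖ ^ 2 := by
  unfold Qf e3
  have h := norm3 z
  rw [h, abs_le]
  fin_cases j <;> simp only [Fin.mk_one, Fin.zero_eta, Fin.reduceFinMk, V3_0, V3_1, V3_2] <;>
  constructor <;>
    nlinarith [sq_nonneg (z 0), sq_nonneg (z 1), sq_nonneg (z 2), sq_nonneg (z 2 - z 0),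
      sq_nonneg (z 2 + z 0), sq_nonneg (z 2 - z 1), sq_nonneg (z 2 + z 1)]

lemma Qf_hom (j : Fin 3) (r : ℝ) (z : E3) : Qf j (r • z) = r ^ 2 * Qf j z := by
  unfold Qf
  rw [norm_smul, mul_pow, Real.norm_eq_abs, sq_abs]
  simp only [PiLp.smul_apply, smul_eq_mul]
  ring

lemma oseen_coord (z : E3) (j : Fin 3) : oseen z e3 j = (8 * π)⁻¹ * Kf (Qf j) z := by
  unfold oseen Kf Qf
  have h : ⟪z, e3⟫ = z 2 := by rw [inner3]; simp [e3, V3_0, V3_1, V3_2]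
  rw [h]
  simp only [PiLp.smul_apply, PiLp.add_apply, smul_eq_mul]
  by_cases hz : ‖z‖ = 0
  · simp [hz]
  · field_simp

lemma oseen_coord_int (x : E3) (hx : ‖x‖ = 1) (j : Fin 3) :
    IntegrableOn (fun z => oseen z e3 j) (Metric.ball x 1) := by
  simp_rw [oseen_coord]
  exact ((Kf_int _ (Qf_cont j) (Qf_bound j)).mono_set (ball_subset_three x hx)).const_mul _

lemma shift (x : E3) (F : E3 → E3) :
    ∫ y in Metric.ball (0 : E3) 1, F (x - y) = ∫ z in Metric.ball x 1, F z := by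
  rw [← integral_indicator Metric.isOpen_ball.measurableSet,
      ← integral_indicator Metric.isOpen_ball.measurableSet,
      ← integral_sub_left_eq_self (indicator (Metric.ball x 1) F) _ x]
  congr 1
  ext1 y
  by_cases h : y ∈ Metric.ball (0 : E3) 1
  · rw [indicator_of_mem h, indicator_of_mem]
    simpa [mem_ball_iff_norm] using h
  · rw [indicator_of_notMem h, indicator_of_notMem]
    simpa [mem_ball_iff_norm] using h

lemma u0_coord (x : E3) (hx : ‖x‖ = 1) (j : Fin 3) :
    u0 x j = -((8 * π)⁻¹ * ∫ z in Metric.ball x 1, Kf (Qf j) z) := by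
  unfold u0
  rw [shift x (fun z => oseen z e3), PiLp.neg_apply, ← integral_const_mul]
  congr 1
  rw [eval_integral_piLp (oseen_coord_int x hx)]
  simp only [oseen_coord]

lemma addI {f g : E3 → ℝ} (hf : Integrable f) (hg : Integrable g) :
    Integrable fun z => f z + g z := hf.add hg

lemma gauss (s c : ℝ) (hs : s ^ 2 + c ^ 2 = 1) (j : Fin 3) :
    Integrable (fun z : E3 => ⟪z, V3 s 0 c⟫ ^ 2 * Qf j z * exp (-‖z‖ ^ 2)) ∧
    ∫ z : E3, ⟪z, V3 s 0 c⟫ ^ 2 * Qf j z * exp (-‖z‖ ^ 2) =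
      √π ^ 3 * (3 / 2 * e3 j + c / 2 * V3 s 0 c j) := by
  fin_cases j
  · have e : (fun z : E3 => ⟪z, V3 s 0 c⟫ ^ 2 * Qf 0 z * exp (-‖z‖ ^ 2)) = fun z =>
        s ^ 2 * mono 3 0 1 z + 2 * s * c * mono 2 0 2 z + c ^ 2 * mono 1 0 3 z := by
      ext z
      simp only [inner3, Qf, mono, e3, V3_0, V3_1, V3_2]
      ring
    simp only [Fin.zero_eta]
    rw [e]
    have i1 := (mono_int 3 0 1).const_mul (s ^ 2)
    have i2 := (mono_int 2 0 2).const_mul (2 * s * c)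
    have i3 := (mono_int 1 0 3).const_mul (c ^ 2)
    refine ⟨addI (addI i1 i2) i3, ?_⟩
    rw [integral_add (addI i1 i2) i3, integral_add i1 i2]
    simp only [integral_const_mul, mono_integral, M0, M1, M2, M3, e3, V3_0]
    ring
  · have e : (fun z : E3 => ⟪z, V3 s 0 c⟫ ^ 2 * Qf 1 z * exp (-‖z‖ ^ 2)) = fun z =>
        s ^ 2 * mono 2 1 1 z + 2 * s * c * mono 1 1 2 z + c ^ 2 * mono 0 1 3 z := by
      ext z
      simp only [inner3, Qf, mono, e3, V3_0, V3_1, V3_2]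
      ring
    simp only [Fin.mk_one]
    rw [e]
    have i1 := (mono_int 2 1 1).const_mul (s ^ 2)
    have i2 := (mono_int 1 1 2).const_mul (2 * s * c)
    have i3 := (mono_int 0 1 3).const_mul (c ^ 2)
    refine ⟨addI (addI i1 i2) i3, ?_⟩
    rw [integral_add (addI i1 i2) i3, integral_add i1 i2]
    simp only [integral_const_mul, mono_integral, M0, M1, M2, M3, e3, V3_1]
    ring
  · have e : (fun z : E3 => ⟪z, V3 s 0 c⟫ ^ 2 * Qf 2 z * exp (-‖z‖ ^ 2)) = fun z =>
        s ^ 2 * mono 4 0 0 z + s ^ 2 * mono 2 2 0 z + (2 * s ^ 2 + c ^ 2) * mono 2 0 2 z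
        + 2 * s * c * mono 3 0 1 z + 2 * s * c * mono 1 2 1 z + 4 * s * c * mono 1 0 3 z
        + c ^ 2 * mono 0 2 2 z + 2 * c ^ 2 * mono 0 0 4 z := by
      ext z
      simp only [inner3, Qf, mono, e3, V3_0, V3_1, V3_2]
      generalize exp (-‖z‖ ^ 2) = t
      rw [norm3]
      ring
    simp only [Fin.reduceFinMk]
    rw [e]
    have i1 := (mono_int 4 0 0).const_mul (s ^ 2)
    have i2 := (mono_int 2 2 0).const_mul (s ^ 2)
    have i3 := (mono_int 2 0 2).const_mul (2 * s ^ 2 + c ^ 2)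
    have i4 := (mono_int 3 0 1).const_mul (2 * s * c)
    have i5 := (mono_int 1 2 1).const_mul (2 * s * c)
    have i6 := (mono_int 1 0 3).const_mul (4 * s * c)
    have i7 := (mono_int 0 2 2).const_mul (c ^ 2)
    have i8 := (mono_int 0 0 4).const_mul (2 * c ^ 2)
    have j2 := addI i1 i2
    have j3 := addI j2 i3
    have j4 := addI j3 i4
    have j5 := addI j4 i5
    have j6 := addI j5 i6
    have j7 := addI j6 i7
    refine ⟨addI j7 i8, ?_⟩
    rw [integral_add j7 i8, integral_add j6 i7, integral_add j5 i6, integral_add j4 i5,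
      integral_add j3 i4, integral_add j2 i3, integral_add i1 i2]
    simp only [integral_const_mul, mono_integral, M0, M1, M2, M3, M4, e3, V3_2]
    linear_combination (3 / 2 * √π ^ 3) * hs

theorem stokes_velocity_on_unit_sphere (θ : ℝ) (hθ : θ ∈ Set.Icc (0 : ℝ) π) :
    u0 (eSph θ 0) =
      (Real.cos θ / 15) • eSph θ 0
        - (2 * Real.sin θ / 15) • V3 (Real.cos θ) 0 (-Real.sin θ)
        - (3 : ℝ)⁻¹ • e3 := by
  have hx : eSph θ 0 = V3 (sin θ) 0 (cos θ) := by simp [eSph]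
  have hsc := Real.sin_sq_add_cos_sq θ
  have hn : ‖V3 (sin θ) 0 (cos θ)‖ = 1 := by
    have h := norm3 (V3 (sin θ) 0 (cos θ))
    rw [V3_0, V3_1, V3_2] at h
    have h2 : ‖V3 (sin θ) 0 (cos θ)‖ ^ 2 = 1 := by rw [h]; linarith
    exact (pow_eq_one_iff_of_nonneg (norm_nonneg _) two_ne_zero).1 h2
  rw [hx]
  have key : ∀ j, u0 (V3 (sin θ) 0 (cos θ)) j =
      -(1 / 5 * e3 j + cos θ / 15 * V3 (sin θ) 0 (cos θ) j) := by
    intro j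
    obtain ⟨hi, hv⟩ := gauss (sin θ) (cos θ) hsc j
    rw [u0_coord _ hn, ball_integral _ (Qf_cont j) (Qf_bound j) (Qf_hom j) _ hn hi, hv]
    have h0 : √π ≠ 0 := (Real.sqrt_pos.2 Real.pi_pos).ne'
    have hp : √π ^ 2 = π := Real.sq_sqrt Real.pi_pos.le
    rw [← hp, Real.sqrt_sq (Real.sqrt_nonneg _)]
    field_simp
    ring
  ext j
  rw [key]
  simp only [PiLp.sub_apply, PiLp.smul_apply, smul_eq_mul]
  fin_cases j <;> simp only [Fin.mk_one, Fin.zero_eta, Fin.reduceFinMk, V3_0, V3_1, V3_2, e3]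
  · ring
  · ring
  · linear_combination (-2 / 15) * hsc
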